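/- Let σ be a mollifier on ℝ^{n−1} and v ∈ C_0^{0,1}(ℝⁿ). With w = √(M̃(v²)) as above, ∫_{ℝⁿ} |∇w|² dx ≤ C ∫_{ℝⁿ} |∇v|² dx for an absolute constant C. -/

import Mathlib

open Real Set MeasureTheory

/-- Convolution with `σ` in the first `n-1` variables:
`M̃(h)(x', x_n) = ∫_{ℝ^{n-1}} h(y', x_n) σ(x' - y') dy'`. -/
noncomputable def Mtilde {m : ℕ} (σ : EuclideanSpace ℝ (Fin m) → ℝ)
    (h : EuclideanSpace ℝ (Fin m) × ℝ → ℝ) (x : EuclideanSpace ℝ (Fin m) × ℝ) : ℝ :=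
  ∫ y : EuclideanSpace ℝ (Fin m), h (y, x.2) * σ (x.1 - y)

/-- `|∇f|²`, the full squared gradient on `ℝ^{n-1} × ℝ`. -/
noncomputable def gradSq {m : ℕ} (f : EuclideanSpace ℝ (Fin m) × ℝ → ℝ)
    (x : EuclideanSpace ℝ (Fin m) × ℝ) : ℝ :=
  (∑ i, (fderiv ℝ f x (EuclideanSpace.single i 1, (0 : ℝ))) ^ 2) +
    (fderiv ℝ f x ((0 : EuclideanSpace ℝ (Fin m)), (1 : ℝ))) ^ 2

open Filter Topology

abbrev Fsp (m : ℕ) := EuclideanSpace ℝ (Fin m) × ℝ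

instance haarF (m : ℕ) : (volume : Measure (Fsp m)).IsAddHaarMeasure :=
  inferInstanceAs ((volume : Measure (EuclideanSpace ℝ (Fin m))).prod
    (volume : Measure ℝ)).IsAddHaarMeasure

/-- Cauchy-Schwarz consequence: reverse triangle inequality in a weighted `L²`. -/
theorem sqrt_sub_sq_le {m : ℕ} (σ a b : EuclideanSpace ℝ (Fin m) → ℝ)
    (hσ : Continuous σ) (hσc : HasCompactSupport σ) (h0 : ∀ x, 0 ≤ σ x)
    (ha : Continuous a) (hb : Continuous b) :
    (√(∫ y, a y ^ 2 * σ y) - √(∫ y, b y ^ 2 * σ y)) ^ 2 ≤ ∫ y, (a y - b y) ^ 2 * σ y := by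
  have int : ∀ f : EuclideanSpace ℝ (Fin m) → ℝ, Continuous f →
      Integrable (fun y => f y * σ y) := fun f hf =>
    (hf.mul hσ).integrable_of_hasCompactSupport hσc.mul_left
  have iA := int (fun y => a y ^ 2) (by fun_prop)
  have iB := int (fun y => b y ^ 2) (by fun_prop)
  have iAB := int (fun y => a y * b y) (by fun_prop)
  set A := ∫ y, a y ^ 2 * σ y with hA
  set B := ∫ y, b y ^ 2 * σ y with hB
  set P := ∫ y, (a y * b y) * σ y with hP
  have key : ∀ t : ℝ, ∫ y, (a y - t * b y) ^ 2 * σ y = B * (t * t) + (-2 * P) * t + A := by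
    intro t
    have : ∀ y, (a y - t * b y) ^ 2 * σ y
        = (t * t) * (b y ^ 2 * σ y) + (-2 * t) * ((a y * b y) * σ y) + a y ^ 2 * σ y := by
      intro y; ring
    simp_rw [this]
    have i2 : Integrable (fun y => (t * t) * (b y ^ 2 * σ y)
        + (-2 * t) * ((a y * b y) * σ y)) := (iB.const_mul _).add (iAB.const_mul _)
    rw [integral_add i2 iA,
      integral_add (iB.const_mul _) (iAB.const_mul _), integral_const_mul, integral_const_mul]
    ring
  have A0 : 0 ≤ A := integral_nonneg fun y => mul_nonneg (sq_nonneg _) (h0 y)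
  have B0 : 0 ≤ B := integral_nonneg fun y => mul_nonneg (sq_nonneg _) (h0 y)
  have hd : discrim B (-2 * P) A ≤ 0 := by
    apply discrim_le_zero
    intro t
    rw [← key t]
    exact integral_nonneg fun y => mul_nonneg (sq_nonneg _) (h0 y)
  have hP2 : P ≤ √A * √B := by
    rw [← Real.sqrt_mul A0]
    apply Real.le_sqrt_of_sq_le
    unfold discrim at hd
    nlinarith
  have k1 := key 1
  simp only [one_mul] at k1
  rw [k1]
  nlinarith [Real.sq_sqrt A0, Real.sq_sqrt B0]

theorem Mtilde_eq {m : ℕ} (σ : EuclideanSpace ℝ (Fin m) → ℝ) (h : Fsp m → ℝ) (x : Fsp m) :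
    Mtilde σ h x = ∫ y, h (x - (y, 0)) * σ y := by
  unfold Mtilde
  rw [← integral_sub_left_eq_self _ volume x.1]
  congr 1
  ext y
  have : x - ((y, 0) : Fsp m) = (x.1 - y, x.2) := by ext <;> simp
  rw [this]; simp

/-- compact support of the sheared product -/
theorem shear_compact {m : ℕ} (σ : EuclideanSpace ℝ (Fin m) → ℝ) (g : Fsp m → ℝ)
    (hσc : HasCompactSupport σ) (hgc : HasCompactSupport g) :
    ∃ S : Set (Fsp m × EuclideanSpace ℝ (Fin m)), IsCompact S ∧
      ∀ p, p ∉ S → g (p.1 - (p.2, 0)) * σ p.2 = 0 := by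
  refine ⟨(fun q : Fsp m × EuclideanSpace ℝ (Fin m) => (q.1 + (q.2, 0), q.2)) ''
    (tsupport g ×ˢ tsupport σ), (hgc.isCompact.prod hσc.isCompact).image (by fun_prop), ?_⟩
  intro p hp
  by_contra hne
  apply hp
  refine ⟨(p.1 - (p.2, 0), p.2), ⟨?_, ?_⟩, by simp⟩
  · exact subset_tsupport _ (left_ne_zero_of_mul hne)
  · exact subset_tsupport _ (right_ne_zero_of_mul hne)

theorem shear_integrable {m : ℕ} (σ : EuclideanSpace ℝ (Fin m) → ℝ) (g : Fsp m → ℝ)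
    (hσ : Continuous σ) (hσc : HasCompactSupport σ) (hg : Continuous g)
    (hgc : HasCompactSupport g) :
    Integrable (fun p : Fsp m × EuclideanSpace ℝ (Fin m) => g (p.1 - (p.2, 0)) * σ p.2)
      (volume.prod volume) := by
  obtain ⟨S, hS, h⟩ := shear_compact σ g hσc hgc
  have hc : Continuous
      (fun p : Fsp m × EuclideanSpace ℝ (Fin m) => g (p.1 - (p.2, 0)) * σ p.2) := by fun_prop
  exact hc.integrable_of_hasCompactSupport (HasCompactSupport.intro hS h)

theorem shear_integral {m : ℕ} (σ : EuclideanSpace ℝ (Fin m) → ℝ) (g : Fsp m → ℝ)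
    (hσ : Continuous σ) (hσc : HasCompactSupport σ) (h1 : ∫ x, σ x = 1) (hg : Continuous g)
    (hgc : HasCompactSupport g) :
    ∫ x : Fsp m, ∫ y, g (x - (y, 0)) * σ y = ∫ x, g x := by
  rw [integral_integral_swap (shear_integrable σ g hσ hσc hg hgc)]
  have : ∀ y : EuclideanSpace ℝ (Fin m), ∫ x : Fsp m, g (x - (y, 0)) * σ y
      = (∫ x, g x) * σ y := by
    intro y
    rw [integral_mul_const, integral_sub_right_eq_self g]
  simp_rw [this]
  rw [integral_const_mul, h1, mul_one]

theorem diff_quot {m : ℕ} (f : Fsp m → ℝ) (K : NNReal) (hf : LipschitzWith K f)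
    (hc : HasCompactSupport f) (ξ : Fsp m) :
    Integrable (fun x => (fderiv ℝ f x ξ) ^ 2) ∧
    Tendsto (fun k : ℕ => ∫ x, ((k + 1 : ℝ) * (f (x + (1 / (k + 1 : ℝ)) • ξ) - f x)) ^ 2) atTop
      (𝓝 (∫ x, (fderiv ℝ f x ξ) ^ 2)) := by
  set S := Metric.cthickening ‖ξ‖ (tsupport f) with hSdef
  have hS : IsCompact S := hc.isCompact.cthickening
  have hsub : tsupport f ⊆ S := Metric.self_subset_cthickening _
  set bd : Fsp m → ℝ := S.indicator (fun _ => (K * ‖ξ‖) ^ 2) with hbd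
  have ibd : Integrable bd := by
    rw [hbd, integrable_indicator_iff hS.measurableSet]
    exact integrableOn_const hS.measure_lt_top.ne
  have bound : ∀ (k : ℕ) x,
      ‖((k + 1 : ℝ) * (f (x + (1 / (k + 1 : ℝ)) • ξ) - f x)) ^ 2‖ ≤ bd x := by
    intro k x
    have kp : (0 : ℝ) < k + 1 := by positivity
    rw [Real.norm_of_nonneg (sq_nonneg _)]
    by_cases hx : x ∈ S
    · rw [hbd, Set.indicator_of_mem hx, ← sq_abs]
      have h := hf.dist_le_mul (x + (1 / (k + 1 : ℝ)) • ξ) x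
      rw [Real.dist_eq, dist_eq_norm, add_sub_cancel_left, norm_smul,
        Real.norm_of_nonneg (by positivity)] at h
      rw [abs_mul, abs_of_pos kp]
      refine pow_le_pow_left₀ (by positivity) ?_ 2
      calc (k + 1 : ℝ) * |f (x + (1 / (k + 1 : ℝ)) • ξ) - f x|
          ≤ (k + 1) * (K * (1 / (k + 1) * ‖ξ‖)) := by gcongr
        _ = K * ‖ξ‖ := by field_simp
    · rw [hbd, Set.indicator_of_notMem hx]
      have e1 : f x = 0 := image_eq_zero_of_notMem_tsupport fun h => hx (hsub h)
      have e2 : f (x + (1 / (k + 1 : ℝ)) • ξ) = 0 := by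
        apply image_eq_zero_of_notMem_tsupport
        intro h
        apply hx
        apply Metric.mem_cthickening_of_dist_le x _ _ _ h
        rw [dist_eq_norm, sub_add_cancel_left, norm_neg, norm_smul,
          Real.norm_of_nonneg (by positivity)]
        apply mul_le_of_le_one_left (norm_nonneg _)
        rw [div_le_one kp]
        have : (0 : ℝ) ≤ k := by positivity
        linarith
      rw [e1, e2]; simp
  have lim : ∀ᵐ x : Fsp m, Tendsto
      (fun k : ℕ => ((k + 1 : ℝ) * (f (x + (1 / (k + 1 : ℝ)) • ξ) - f x)) ^ 2) atTop
      (𝓝 ((fderiv ℝ f x ξ) ^ 2)) := by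
    filter_upwards [hf.ae_differentiableAt (μ := volume)] with x hx
    apply Tendsto.pow
    have h := hx.hasFDerivAt.hasLineDerivAt ξ
    have h2 := h.tendsto_slope_zero
    have h3 : Tendsto (fun k : ℕ => 1 / (k + 1 : ℝ)) atTop (𝓝[≠] 0) := by
      apply tendsto_nhdsWithin_iff.2 ⟨tendsto_one_div_add_atTop_nhds_zero_nat, ?_⟩
      filter_upwards with k
      have : (0 : ℝ) < 1 / (k + 1) := by positivity
      exact this.ne'
    have h4 := h2.comp h3
    refine h4.congr ?_
    intro k
    simp
  have cont : Continuous f := hf.continuous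
  refine ⟨?_, ?_⟩
  · refine ibd.mono' ((measurable_fderiv_apply_const ℝ f ξ).pow_const 2).aestronglyMeasurable ?_
    filter_upwards [lim] with x hx
    exact le_of_tendsto hx.norm (Eventually.of_forall fun k => bound k x)
  · apply tendsto_integral_of_dominated_convergence bd _ ibd
      (fun k => Eventually.of_forall (bound k)) lim
    intro k
    exact Continuous.aestronglyMeasurable (by fun_prop)

theorem w_lip {m : ℕ} (σ : EuclideanSpace ℝ (Fin m) → ℝ)
    (hσ : Continuous σ) (hσc : HasCompactSupport σ) (h0 : ∀ x, 0 ≤ σ x) (h1 : ∫ x, σ x = 1)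
    (v : Fsp m → ℝ) (K : NNReal) (hv : LipschitzWith K v) :
    LipschitzWith K (fun z => √(Mtilde σ (fun y => v y ^ 2) z)) := by
  have cont := hv.continuous
  apply LipschitzWith.of_dist_le_mul
  intro x z
  rw [Real.dist_eq]
  apply abs_le_of_sq_le_sq _ (by positivity)
  rw [Mtilde_eq, Mtilde_eq]
  refine (sqrt_sub_sq_le σ (fun y => v (x - (y, 0))) (fun y => v (z - (y, 0))) hσ hσc h0
    (by fun_prop) (by fun_prop)).trans ?_
  calc ∫ y, (v (x - (y, 0)) - v (z - (y, 0))) ^ 2 * σ y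
      ≤ ∫ y, (K * dist x z) ^ 2 * σ y := by
        apply integral_mono
        · exact Continuous.integrable_of_hasCompactSupport (by fun_prop) hσc.mul_left
        · exact Continuous.integrable_of_hasCompactSupport (by fun_prop) hσc.mul_left
        · intro y
          apply mul_le_mul_of_nonneg_right _ (h0 y)
          apply sq_le_sq'
          all_goals
            have h := hv.dist_le_mul (x - (y, 0)) (z - (y, 0))
            rw [dist_sub_right, Real.dist_eq, abs_le] at h
            linarith [h.1, h.2]
    _ = (K * dist x z) ^ 2 := by rw [integral_const_mul, h1, mul_one]

theorem w_supp {m : ℕ} (σ : EuclideanSpace ℝ (Fin m) → ℝ)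
    (hσc : HasCompactSupport σ) (v : Fsp m → ℝ) (hvc : HasCompactSupport v) :
    HasCompactSupport (fun z => √(Mtilde σ (fun y => v y ^ 2) z)) := by
  have hv2 : HasCompactSupport (fun y => v y ^ 2) :=
    hvc.comp_left (g := fun t : ℝ => t ^ 2) (by simp)
  obtain ⟨S, hS, h⟩ := shear_compact σ (fun y => v y ^ 2) hσc hv2
  refine HasCompactSupport.intro (hS.image continuous_fst) ?_
  intro x hx
  rw [Mtilde_eq]
  have : ∀ y, v (x - (y, 0)) ^ 2 * σ y = 0 := fun y =>
    h (x, y) fun hm => hx ⟨_, hm, rfl⟩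
  simp [this]

theorem dir_le {m : ℕ} (σ : EuclideanSpace ℝ (Fin m) → ℝ)
    (hσ : Continuous σ) (hσc : HasCompactSupport σ) (h0 : ∀ x, 0 ≤ σ x) (h1 : ∫ x, σ x = 1)
    (v : Fsp m → ℝ) (K : NNReal) (hv : LipschitzWith K v) (hvc : HasCompactSupport v)
    (ξ : Fsp m) :
    ∫ x, (fderiv ℝ (fun z => √(Mtilde σ (fun y => v y ^ 2) z)) x ξ) ^ 2
      ≤ ∫ x, (fderiv ℝ v x ξ) ^ 2 := by
  have wl := w_lip σ hσ hσc h0 h1 v K hv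
  have ws := w_supp σ hσc v hvc
  generalize hw : (fun z => √(Mtilde σ (fun y => v y ^ 2) z)) = w at wl ws ⊢
  have hw' : ∀ z, w z = √(∫ y, v (z - (y, 0)) ^ 2 * σ y) := by
    intro z
    rw [← hw, ← Mtilde_eq σ (fun y => v y ^ 2)]
  refine le_of_tendsto_of_tendsto' (diff_quot _ K wl ws ξ).2 (diff_quot v K hv hvc ξ).2 ?_
  intro k
  have cont := hv.continuous
  have wcont := wl.continuous
  set c : ℝ := k + 1
  set η : Fsp m := (1 / c) • ξ
  have supp : ∀ f : Fsp m → ℝ, HasCompactSupport f →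
      HasCompactSupport (fun x => (c * (f (x + η) - f x)) ^ 2) := by
    intro f hf
    have h2 : HasCompactSupport (fun x => f (x + η)) :=
      hf.comp_homeomorph (Homeomorph.addRight η)
    exact (h2.sub hf).comp_left (g := fun t : ℝ => (c * t) ^ 2) (by simp)
  have sv := supp v hvc
  have cv : Continuous (fun x => (c * (v (x + η) - v x)) ^ 2) := by fun_prop
  rw [← shear_integral σ _ hσ hσc h1 cv sv]
  apply integral_mono
  · exact Continuous.integrable_of_hasCompactSupport (by fun_prop) (supp w ws)
  · exact (shear_integrable σ _ hσ hσc cv sv).integral_prod_left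
  · intro x
    have h := sqrt_sub_sq_le σ (fun y => v (x + η - (y, 0))) (fun y => v (x - (y, 0))) hσ hσc h0
      (by fun_prop) (by fun_prop)
    simp only [hw', mul_pow]
    simp_rw [mul_assoc]
    rw [integral_const_mul]
    apply mul_le_mul_of_nonneg_left _ (sq_nonneg _)
    simp_rw [sub_add_eq_add_sub]
    exact h

theorem grad_int {m : ℕ} (f : Fsp m → ℝ) (K : NNReal) (hf : LipschitzWith K f)
    (hc : HasCompactSupport f) :
    ∫ x, gradSq f x = (∑ i, ∫ x, (fderiv ℝ f x (EuclideanSpace.single i 1, (0 : ℝ))) ^ 2) +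
      ∫ x, (fderiv ℝ f x ((0 : EuclideanSpace ℝ (Fin m)), (1 : ℝ))) ^ 2 := by
  unfold gradSq
  have i := fun ξ => (diff_quot f K hf hc ξ).1
  rw [integral_add (integrable_finsetSum _ fun j _ => i _) (i _),
    integral_finsetSum _ fun j _ => i _]

theorem stmt15 :
    ∃ C : ℝ, 0 < C ∧
      ∀ (n : ℕ), 1 ≤ n →
      ∀ σ : EuclideanSpace ℝ (Fin (n - 1)) → ℝ,
        ContDiff ℝ (⊤ : ℕ∞) σ → HasCompactSupport σ → (∀ x, 0 ≤ σ x) →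
        (∫ x, σ x) = 1 →
      ∀ v : EuclideanSpace ℝ (Fin (n - 1)) × ℝ → ℝ,
        (∃ K, LipschitzWith K v) → HasCompactSupport v →
        ∫ x : EuclideanSpace ℝ (Fin (n - 1)) × ℝ,
            gradSq (fun z => Real.sqrt (Mtilde σ (fun y => (v y) ^ 2) z)) x ≤
          C * ∫ x : EuclideanSpace ℝ (Fin (n - 1)) × ℝ, gradSq v x := by
  refine ⟨1, one_pos, ?_⟩
  intro n _ σ hσ hσc h0 h1 v ⟨K, hv⟩ hvc
  have hs := hσ.continuous
  rw [one_mul, grad_int _ K (w_lip σ hs hσc h0 h1 v K hv) (w_supp σ hσc v hvc),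
    grad_int v K hv hvc]
  exact add_le_add (Finset.sum_le_sum fun i _ => dir_le σ hs hσc h0 h1 v K hv hvc _)
    (dir_le σ hs hσc h0 h1 v K hv hvc _)
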